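/- Let x : V → R^d with Σ_i d_i‖x_i‖² = vol(G) and let x̃ be its entrywise normalization. If λ₂(L₀) > 0 then η(x̃) ≤ 44·η(x)/λ₂(L₀). -/

import Mathlib

open Matrix
open scoped Classical

lemma spec_aux {n : ℕ} (hn : 1 < n) (A : Matrix (Fin n) (Fin n) ℝ) (hA : A.IsHermitian)
    (lam : ℝ) (hlam : lam = (hA.eigenvalues ∘ Tuple.sort hA.eigenvalues) ⟨1, hn⟩)
    (hpos : 0 < lam) (u g : Fin n → ℝ) (hu : A *ᵥ u = 0) (hu0 : 0 < u ⬝ᵥ u) :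
    lam * ((u ⬝ᵥ u) * (g ⬝ᵥ g) - (g ⬝ᵥ u) ^ 2) ≤ (u ⬝ᵥ u) * (g ⬝ᵥ A *ᵥ g) := by
  set k0 : Fin n := Tuple.sort hA.eigenvalues ⟨0, by omega⟩ with hk0
  have hge : ∀ k, k ≠ k0 → lam ≤ hA.eigenvalues k := by
    intro k hk
    obtain ⟨j, rfl⟩ := (Tuple.sort hA.eigenvalues).surjective k
    have hj : (⟨1, hn⟩ : Fin n) ≤ j := by
      rw [Fin.le_def]
      by_contra h
      apply hk
      rw [hk0]
      congr 1
      ext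
      simp at h ⊢
      omega
    rw [hlam]
    exact Tuple.monotone_sort hA.eigenvalues hj
  let b : Fin n → Fin n → ℝ := fun k => (hA.eigenvectorBasis k).ofLp
  have hpars : ∀ p q : Fin n → ℝ, p ⬝ᵥ q = ∑ k, (b k ⬝ᵥ p) * (b k ⬝ᵥ q) := by
    intro p q
    have := hA.eigenvectorBasis.sum_inner_mul_inner (WithLp.toLp 2 p) (WithLp.toLp 2 q)
    simp only [EuclideanSpace.inner_eq_star_dotProduct, star_trivial] at this
    rw [dotProduct_comm, ← this]
    refine Finset.sum_congr rfl fun k _ => ?_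
    rw [dotProduct_comm q]
  have hAb : ∀ k (p : Fin n → ℝ), b k ⬝ᵥ A *ᵥ p = hA.eigenvalues k * (b k ⬝ᵥ p) := by
    intro k p
    have h1 : A *ᵥ b k = hA.eigenvalues k • b k := hA.mulVec_eigenvectorBasis k
    have hT : Aᵀ = A := by simpa [Matrix.IsHermitian, conjTranspose_eq_transpose_of_trivial] using hA
    rw [dotProduct_mulVec, ← mulVec_transpose, hT, h1, smul_dotProduct, smul_eq_mul]
  have hz : ∀ k, k ≠ k0 → b k ⬝ᵥ u = 0 := by
    intro k hk
    have := hAb k u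
    rw [hu, dotProduct_zero] at this
    have h2 := hge k hk
    rcases mul_eq_zero.1 this.symm with h | h
    · linarith
    · exact h
  have hsing : ∀ p : Fin n → ℝ, p ⬝ᵥ u = (b k0 ⬝ᵥ p) * (b k0 ⬝ᵥ u) := by
    intro p
    rw [hpars p u]
    refine Finset.sum_eq_single k0 (fun k _ hk => by rw [hz k hk, mul_zero]) (by simp)
  set c := b k0 ⬝ᵥ u with hc
  have huu : u ⬝ᵥ u = c ^ 2 := by rw [hsing u]; ring
  have hc0 : c ≠ 0 := by rintro h; rw [huu, h] at hu0; simp at hu0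
  have hl0 : hA.eigenvalues k0 = 0 := by
    have := hAb k0 u
    rw [hu, dotProduct_zero] at this
    rcases mul_eq_zero.1 this.symm with h | h
    · exact h
    · exact absurd h hc0
  have hkey : lam * (g ⬝ᵥ g - (b k0 ⬝ᵥ g) ^ 2) ≤ g ⬝ᵥ A *ᵥ g := by
    rw [hpars g g, hpars g (A *ᵥ g), ← Finset.add_sum_erase _ _ (Finset.mem_univ k0),
      ← Finset.add_sum_erase Finset.univ (fun k => (b k ⬝ᵥ g) * (b k ⬝ᵥ A *ᵥ g)) (Finset.mem_univ k0)]
    simp only [hAb, hl0]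
    rw [show ∀ t s : ℝ, lam * (t * t + s - t ^ 2) = lam * s by intros; ring, Finset.mul_sum]
    rw [zero_mul, mul_zero, zero_add]
    refine Finset.sum_le_sum fun k hk => ?_
    have := hge k (Finset.ne_of_mem_erase hk)
    nlinarith [mul_le_mul_of_nonneg_right this (sq_nonneg (b k ⬝ᵥ g))]
  rw [hsing g, huu]
  nlinarith [mul_le_mul_of_nonneg_left hkey (sq_nonneg c)]

lemma sum_swap {n : ℕ} (w : Fin n → Fin n → ℝ) (hwsymm : ∀ i j, w i j = w j i) (h : Fin n → ℝ) :
    ∑ i, ∑ j, w i j * h j = ∑ i, (∑ j, w i j) * h i := by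
  rw [Finset.sum_comm]
  refine Finset.sum_congr rfl fun i _ => ?_
  rw [Finset.sum_mul]
  exact Finset.sum_congr rfl fun j _ => by rw [hwsymm]

lemma sum_fst {n : ℕ} (w : Fin n → Fin n → ℝ) (h : Fin n → ℝ) :
    ∑ i, ∑ j, w i j * h i = ∑ i, (∑ j, w i j) * h i := by
  simp [Finset.sum_mul]

lemma poincare {n : ℕ} (hn : 1 < n) (w : Fin n → Fin n → ℝ)
    (hwsymm : ∀ i j, w i j = w j i)
    (hdeg : ∀ i, 0 < ∑ j, w i j)
    (L0 : Matrix (Fin n) (Fin n) ℝ)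
    (hL0 : L0 = 1 - Matrix.of (fun i j : Fin n =>
        w i j / (Real.sqrt (∑ k, w i k) * Real.sqrt (∑ k, w j k))))
    (hherm : L0.IsHermitian)
    (lam2 : ℝ)
    (hlam2 : lam2 = (hherm.eigenvalues ∘ Tuple.sort hherm.eigenvalues) ⟨1, hn⟩)
    (hpos : 0 < lam2) (f : Fin n → ℝ) :
    lam2 * ((∑ i, ∑ j, w i j) * (∑ i, (∑ j, w i j) * f i ^ 2) - (∑ i, (∑ j, w i j) * f i) ^ 2)
      ≤ (∑ i, ∑ j, w i j) * ((1 / 2) * ∑ i, ∑ j, w i j * (f i - f j) ^ 2) := by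
  set s : Fin n → ℝ := fun i => Real.sqrt (∑ k, w i k) with hs
  have hspos : ∀ i, 0 < s i := fun i => Real.sqrt_pos.2 (hdeg i)
  have hss : ∀ i, s i * s i = ∑ k, w i k := fun i => Real.mul_self_sqrt (hdeg i).le
  have hmul : ∀ h : Fin n → ℝ, ∀ i, (L0 *ᵥ fun j => s j * h j) i
      = s i * h i - (∑ j, w i j * h j) / s i := by
    intro h i
    rw [hL0, sub_mulVec, one_mulVec, Pi.sub_apply]
    congr 1
    simp only [mulVec, dotProduct, of_apply]
    rw [Finset.sum_div]
    refine Finset.sum_congr rfl fun j _ => ?_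
    have h1 := (hspos i).ne'
    have h2 := (hspos j).ne'
    change w i j / (s i * s j) * (s j * h j) = _
    field_simp
  have hu : L0 *ᵥ (fun j => s j * 1) = 0 := by
    ext i
    rw [hmul (fun _ => 1) i]
    simp only [mul_one, Pi.zero_apply]
    rw [← hss, mul_div_assoc, div_self (hspos i).ne']; ring
  have huu : (fun j => s j * 1) ⬝ᵥ (fun j => s j * 1) = ∑ i, ∑ j, w i j := by
    simp only [dotProduct, mul_one, hss]
  have hvol : 0 < ∑ i, ∑ j, w i j :=
    Finset.sum_pos (fun i _ => hdeg i) ⟨⟨0, by omega⟩, Finset.mem_univ _⟩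
  have := spec_aux hn L0 hherm lam2 hlam2 hpos (fun j => s j * 1) (fun j => s j * f j) hu
    (by rw [huu]; exact hvol)
  rw [huu] at this
  have hgg : (fun j => s j * f j) ⬝ᵥ (fun j => s j * f j) = ∑ i, (∑ j, w i j) * f i ^ 2 := by
    simp only [dotProduct]
    refine Finset.sum_congr rfl fun i _ => ?_
    rw [← hss]; ring
  have hgu : (fun j => s j * f j) ⬝ᵥ (fun j => s j * 1) = ∑ i, (∑ j, w i j) * f i := by
    simp only [dotProduct]
    refine Finset.sum_congr rfl fun i _ => ?_
    rw [← hss]; ring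
  have hgL : (fun j => s j * f j) ⬝ᵥ (L0 *ᵥ fun j => s j * f j)
      = (1 / 2) * ∑ i, ∑ j, w i j * (f i - f j) ^ 2 := by
    have e1 : ∑ i, ∑ j, w i j * (f i - f j) ^ 2
        = ∑ i, ∑ j, w i j * f i ^ 2 + ∑ i, ∑ j, w i j * f j ^ 2
          - 2 * ∑ i, f i * ∑ j, w i j * f j := by
      simp only [Finset.mul_sum, ← Finset.sum_add_distrib, ← Finset.sum_sub_distrib]
      refine Finset.sum_congr rfl fun i _ => Finset.sum_congr rfl fun j _ => by ring
    rw [e1, sum_fst w (fun i => f i ^ 2), sum_swap w hwsymm (fun i => f i ^ 2), ← hgg]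
    simp only [dotProduct, hmul]
    rw [show ∀ a b : ℝ, 1 / 2 * (a + a - 2 * b) = a - b by intros; ring, ← Finset.sum_sub_distrib]
    refine Finset.sum_congr rfl fun i _ => ?_
    have h1 := (hspos i).ne'
    field_simp
  rw [hgg, hgu, hgL] at this
  exact this

lemma lam_le_two {n : ℕ} (hn : 1 < n) (w : Fin n → Fin n → ℝ)
    (hw : ∀ i j, 0 ≤ w i j) (hwsymm : ∀ i j, w i j = w j i)
    (hdeg : ∀ i, 0 < ∑ j, w i j) (lam : ℝ)
    (hP : ∀ f : Fin n → ℝ,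
      lam * ((∑ i, ∑ j, w i j) * (∑ i, (∑ j, w i j) * f i ^ 2) - (∑ i, (∑ j, w i j) * f i) ^ 2)
      ≤ (∑ i, ∑ j, w i j) * ((1 / 2) * ∑ i, ∑ j, w i j * (f i - f j) ^ 2)) : lam ≤ 2 := by
  set vol := ∑ i, ∑ j, w i j with hv
  set a : Fin n := ⟨0, by omega⟩
  set c : Fin n := ⟨1, hn⟩
  have hac : a ≠ c := by simp [a, c, Fin.ext_iff]
  set da := ∑ j, w a j with hda
  have hdapos : 0 < da := hdeg a
  have hlt : da < vol := by
    have h1 : da + ∑ j, w c j ≤ vol := by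
      have := Finset.sum_le_sum_of_subset_of_nonneg (Finset.subset_univ ({a, c} : Finset (Fin n)))
        (f := fun i => ∑ j, w i j) (fun i _ _ => (hdeg i).le)
      rwa [Finset.sum_pair hac] at this
    linarith [hdeg c]
  have hP1 := hP (fun i => (if i = a then 1 else 0) - da / vol)
  set f : Fin n → ℝ := fun i => (if i = a then 1 else 0) - da / vol with hf
  have hvol : 0 < vol := hdapos.trans hlt
  have hM : ∑ i, (∑ j, w i j) * f i = 0 := by
    simp only [hf, mul_sub, Finset.sum_sub_distrib, ← Finset.sum_mul]
    simp [← hv, ← hda]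
    field_simp
    simp
  have hQ : 0 < ∑ i, (∑ j, w i j) * f i ^ 2 := by
    refine Finset.sum_pos' (fun i _ => mul_nonneg (hdeg i).le (sq_nonneg _)) ⟨a, Finset.mem_univ _, ?_⟩
    have : 0 < f a := by
      simp only [hf, if_true]
      rw [sub_pos, div_lt_one hvol]; exact hlt
    exact mul_pos (hdeg a) (by positivity)
  have hE : (1 / 2) * ∑ i, ∑ j, w i j * (f i - f j) ^ 2 ≤ 2 * ∑ i, (∑ j, w i j) * f i ^ 2 := by
    have : ∑ i, ∑ j, w i j * (f i - f j) ^ 2 ≤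
        2 * ∑ i, ∑ j, w i j * f i ^ 2 + 2 * ∑ i, ∑ j, w i j * f j ^ 2 := by
      simp only [Finset.mul_sum, ← Finset.sum_add_distrib]
      refine Finset.sum_le_sum fun i _ => Finset.sum_le_sum fun j _ => ?_
      nlinarith [mul_nonneg (hw i j) (sq_nonneg (f i + f j))]
    rw [sum_fst w (fun i => f i ^ 2), sum_swap w hwsymm (fun i => f i ^ 2)] at this
    linarith
  rw [hM] at hP1
  set Q := ∑ i, (∑ j, w i j) * f i ^ 2
  have h3 : lam * (vol * Q) ≤ 2 * (vol * Q) := by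
    nlinarith [mul_le_mul_of_nonneg_left hE hvol.le]
  exact le_of_mul_le_mul_right h3 (mul_pos hvol hQ)

lemma orth_norm {d : ℕ} (R : Matrix (Fin d) (Fin d) ℝ) (hR : R ∈ Matrix.orthogonalGroup (Fin d) ℝ)
    (y : EuclideanSpace ℝ (Fin d)) : ‖Matrix.toEuclideanLin R y‖ = ‖y‖ := by
  have h : Rᵀ * R = 1 := (Matrix.mem_orthogonalGroup_iff' (Fin d) ℝ).1 hR
  have : ‖Matrix.toEuclideanLin R y‖ ^ 2 = ‖y‖ ^ 2 := by
    rw [← real_inner_self_eq_norm_sq, ← real_inner_self_eq_norm_sq]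
    simp only [EuclideanSpace.inner_eq_star_dotProduct, star_trivial]
    simp only [Matrix.ofLp_toEuclideanLin_apply]
    rw [dotProduct_mulVec, ← mulVec_transpose, mulVec_mulVec, h, one_mulVec]
  exact (sq_eq_sq₀ (norm_nonneg _) (norm_nonneg _)).1 this

lemma edge_bound {F : Type*} [NormedAddCommGroup F] [InnerProductSpace ℝ F] (T : F →ₗ[ℝ] F)
    (hT : ∀ y, ‖T y‖ = ‖y‖) (x y xt yt : F)
    (hx : xt = if x = 0 then 0 else ‖x‖⁻¹ • x) (hy : yt = if y = 0 then 0 else ‖y‖⁻¹ • y) :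
    ‖xt - T yt‖ ^ 2 ≤ 25 / 4 * ‖x - T y‖ ^ 2
      + 100 / 9 * ((‖x‖ - 1) ^ 2 + (‖y‖ - 1) ^ 2) := by
  have nle : ∀ z zt : F, (zt = if z = 0 then 0 else ‖z‖⁻¹ • z) → ‖zt‖ ≤ 1 := by
    intro z zt h
    rw [h]
    split_ifs with h0
    · simp
    · rw [norm_smul, norm_inv, norm_norm, inv_mul_cancel₀ (norm_ne_zero_iff.2 h0)]
  have h4 : ‖xt - T yt‖ ^ 2 ≤ 4 := by
    have h1 : ‖xt - T yt‖ ≤ 2 := by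
      have := norm_sub_le xt (T yt)
      rw [hT] at this
      linarith [nle x xt hx, nle y yt hy]
    nlinarith [norm_nonneg (xt - T yt)]
  by_cases hbx : ‖x‖ < 2 / 5
  · nlinarith [sq_nonneg ‖x - T y‖, sq_nonneg (‖y‖ - 1)]
  by_cases hby : ‖y‖ < 2 / 5
  · nlinarith [sq_nonneg ‖x - T y‖, sq_nonneg (‖x‖ - 1)]
  push Not at hbx hby
  have hx0 : x ≠ 0 := by rintro rfl; simp at hbx; linarith
  have hy0 : y ≠ 0 := by rintro rfl; simp at hby; linarith
  rw [if_neg hx0] at hx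
  rw [if_neg hy0] at hy
  have ex : x = ‖x‖ • xt := by rw [hx, smul_smul, mul_inv_cancel₀ (norm_ne_zero_iff.2 hx0), one_smul]
  have ey : y = ‖y‖ • yt := by rw [hy, smul_smul, mul_inv_cancel₀ (norm_ne_zero_iff.2 hy0), one_smul]
  have nx : ‖xt‖ = 1 := by
    rw [hx, norm_smul, norm_inv, norm_norm, inv_mul_cancel₀ (norm_ne_zero_iff.2 hx0)]
  have ny : ‖T yt‖ = 1 := by
    rw [hT, hy, norm_smul, norm_inv, norm_norm, inv_mul_cancel₀ (norm_ne_zero_iff.2 hy0)]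
  have hid : ‖x - T y‖ ^ 2 = (‖x‖ - ‖y‖) ^ 2 + ‖x‖ * ‖y‖ * ‖xt - T yt‖ ^ 2 := by
    have i1 : inner ℝ x (T y) = ‖x‖ * ‖y‖ * inner ℝ xt (T yt) := by
      conv_lhs => rw [ex, ey]
      rw [map_smul, real_inner_smul_left, real_inner_smul_right]; ring
    rw [norm_sub_sq_real, norm_sub_sq_real, i1, hT, nx, ny]; ring
  have hprod : 4 / 25 ≤ ‖x‖ * ‖y‖ := by nlinarith
  have := mul_le_mul_of_nonneg_right hprod (sq_nonneg ‖xt - T yt‖)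
  nlinarith [sq_nonneg (‖x‖ - ‖y‖), sq_nonneg (‖x‖ - 1), sq_nonneg (‖y‖ - 1)]

theorem stmt_15 (n d : ℕ) (hn : 1 < n) (w : Fin n → Fin n → ℝ)
    (hw : ∀ i j, 0 ≤ w i j) (hwsymm : ∀ i j, w i j = w j i)
    (hdeg : ∀ i, 0 < ∑ j, w i j)
    (ρ : Fin n → Fin n → Matrix (Fin d) (Fin d) ℝ)
    (hρ : ∀ i j, ρ i j ∈ Matrix.orthogonalGroup (Fin d) ℝ)
    (hρsymm : ∀ i j, ρ j i = (ρ i j)ᵀ)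
    (L0 : Matrix (Fin n) (Fin n) ℝ)
    (hL0 : L0 = 1 - Matrix.of (fun i j : Fin n =>
        w i j / (Real.sqrt (∑ k, w i k) * Real.sqrt (∑ k, w j k))))
    (hherm : L0.IsHermitian)
    (lam2 : ℝ)
    (hlam2 : lam2 = (hherm.eigenvalues ∘ Tuple.sort hherm.eigenvalues) ⟨1, hn⟩)
    (hpos : 0 < lam2)
    (x : Fin n → EuclideanSpace ℝ (Fin d))
    (hnorm : ∑ i, (∑ j, w i j) * ‖x i‖ ^ 2 = ∑ i, ∑ j, w i j)
    (xt : Fin n → EuclideanSpace ℝ (Fin d))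
    (hxt : ∀ i, xt i = if x i = 0 then 0 else ‖x i‖⁻¹ • x i) :
    ((1 / 2) * ∑ i, ∑ j, w i j * ‖xt i - Matrix.toEuclideanLin (ρ i j) (xt j)‖ ^ 2) /
        (∑ i, (∑ j, w i j) * ‖xt i‖ ^ 2)
      ≤ 44 *
        ((((1 / 2) * ∑ i, ∑ j, w i j * ‖x i - Matrix.toEuclideanLin (ρ i j) (x j)‖ ^ 2) /
            (∑ i, (∑ j, w i j) * ‖x i‖ ^ 2)) / lam2) := by
  have hP := poincare hn w hwsymm hdeg L0 hL0 hherm lam2 hlam2 hpos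
  have hl2 := lam_le_two hn w hw hwsymm hdeg lam2 hP
  have hT : ∀ i j y, ‖Matrix.toEuclideanLin (ρ i j) y‖ = ‖y‖ := fun i j y => orth_norm _ (hρ i j) y
  have hvol : 0 < ∑ i, ∑ j, w i j :=
    Finset.sum_pos (fun i _ => hdeg i) ⟨⟨0, by omega⟩, Finset.mem_univ _⟩
  have hPx := hP (fun i => ‖x i‖)
  rw [hnorm] at hPx ⊢
  set vol := ∑ i, ∑ j, w i j with hv
  set M := ∑ i, (∑ j, w i j) * ‖x i‖ with hM
  have hM0 : 0 ≤ M := Finset.sum_nonneg fun i _ => mul_nonneg (hdeg i).le (norm_nonneg _)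
  have hD : ∑ i, (∑ j, w i j) * (‖x i‖ - 1) ^ 2 = 2 * vol - 2 * M := by
    have : ∑ i, (∑ j, w i j) * (‖x i‖ - 1) ^ 2
        = ∑ i, (∑ j, w i j) * ‖x i‖ ^ 2 - 2 * M + vol := by
      rw [hM, hv, Finset.mul_sum, ← Finset.sum_sub_distrib, ← Finset.sum_add_distrib]
      exact Finset.sum_congr rfl fun i _ => by ring
    rw [this, hnorm]; ring
  have hD0 : 0 ≤ 2 * vol - 2 * M := by
    rw [← hD]; exact Finset.sum_nonneg fun i _ => mul_nonneg (hdeg i).le (sq_nonneg _)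
  have hradial : ∑ i, ∑ j, w i j * (‖x i‖ - ‖x j‖) ^ 2
      ≤ ∑ i, ∑ j, w i j * ‖x i - Matrix.toEuclideanLin (ρ i j) (x j)‖ ^ 2 := by
    refine Finset.sum_le_sum fun i _ => Finset.sum_le_sum fun j _ => ?_
    refine mul_le_mul_of_nonneg_left ?_ (hw i j)
    have := abs_norm_sub_norm_le (x i) (Matrix.toEuclideanLin (ρ i j) (x j))
    rw [hT] at this
    rw [← sq_abs (‖x i‖ - ‖x j‖)]
    exact pow_le_pow_left₀ (abs_nonneg _) this 2
  have hEdge : ∑ i, ∑ j, w i j * ‖xt i - Matrix.toEuclideanLin (ρ i j) (xt j)‖ ^ 2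
      ≤ 25 / 4 * ∑ i, ∑ j, w i j * ‖x i - Matrix.toEuclideanLin (ρ i j) (x j)‖ ^ 2
        + 100 / 9 * (2 * (2 * vol - 2 * M)) := by
    have : ∑ i, ∑ j, w i j * ‖xt i - Matrix.toEuclideanLin (ρ i j) (xt j)‖ ^ 2
      ≤ 25 / 4 * ∑ i, ∑ j, w i j * ‖x i - Matrix.toEuclideanLin (ρ i j) (x j)‖ ^ 2
        + 100 / 9 * (∑ i, ∑ j, w i j * (‖x i‖ - 1) ^ 2 + ∑ i, ∑ j, w i j * (‖x j‖ - 1) ^ 2) := by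
      simp only [Finset.mul_sum, ← Finset.sum_add_distrib]
      refine Finset.sum_le_sum fun i _ => Finset.sum_le_sum fun j _ => ?_
      have := mul_le_mul_of_nonneg_left
        (edge_bound (Matrix.toEuclideanLin (ρ i j)) (hT i j) (x i) (x j) (xt i) (xt j)
          (by rw [hxt i]; congr) (by rw [hxt j]; congr))
        (hw i j)
      linarith
    rw [sum_fst w (fun i => (‖x i‖ - 1) ^ 2), sum_swap w hwsymm (fun i => (‖x i‖ - 1) ^ 2), hD] at this
    linarith
  have hTwo : ∑ i, ∑ j, w i j * ‖xt i - Matrix.toEuclideanLin (ρ i j) (xt j)‖ ^ 2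
      ≤ 4 * ∑ i, (∑ j, w i j) * ‖xt i‖ ^ 2 := by
    have : ∑ i, ∑ j, w i j * ‖xt i - Matrix.toEuclideanLin (ρ i j) (xt j)‖ ^ 2
      ≤ 2 * ∑ i, ∑ j, w i j * ‖xt i‖ ^ 2 + 2 * ∑ i, ∑ j, w i j * ‖xt j‖ ^ 2 := by
      simp only [Finset.mul_sum, ← Finset.sum_add_distrib]
      refine Finset.sum_le_sum fun i _ => Finset.sum_le_sum fun j _ => ?_
      have h1 := norm_sub_le (xt i) (Matrix.toEuclideanLin (ρ i j) (xt j))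
      rw [hT] at h1
      have h2 : ‖xt i - Matrix.toEuclideanLin (ρ i j) (xt j)‖ ^ 2
          ≤ 2 * ‖xt i‖ ^ 2 + 2 * ‖xt j‖ ^ 2 := by
        have := pow_le_pow_left₀ (norm_nonneg _) h1 2
        nlinarith [sq_nonneg (‖xt i‖ - ‖xt j‖)]
      have := mul_le_mul_of_nonneg_left h2 (hw i j)
      linarith
    rw [sum_fst w (fun i => ‖xt i‖ ^ 2), sum_swap w hwsymm (fun i => ‖xt i‖ ^ 2)] at this
    linarith
  have hVs : vol - (2 * vol - 2 * M) ≤ ∑ i, (∑ j, w i j) * ‖xt i‖ ^ 2 := by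
    rw [← hD, hv, ← Finset.sum_sub_distrib]
    refine Finset.sum_le_sum fun i _ => ?_
    have : 1 - (‖x i‖ - 1) ^ 2 ≤ ‖xt i‖ ^ 2 := by
      rw [hxt i]
      split_ifs with h0
      · simp [h0]
      · rw [norm_smul, norm_inv, norm_norm, inv_mul_cancel₀ (norm_ne_zero_iff.2 h0)]
        nlinarith [sq_nonneg (‖x i‖ - 1)]
    have := mul_le_mul_of_nonneg_left this (hdeg i).le
    linarith
  have hVs0 : 0 ≤ ∑ i, (∑ j, w i j) * ‖xt i‖ ^ 2 :=
    Finset.sum_nonneg fun i _ => mul_nonneg (hdeg i).le (sq_nonneg _)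
  have hE0 : 0 ≤ ∑ i, ∑ j, w i j * ‖x i - Matrix.toEuclideanLin (ρ i j) (x j)‖ ^ 2 :=
    Finset.sum_nonneg fun i _ => Finset.sum_nonneg fun j _ => mul_nonneg (hw i j) (sq_nonneg _)
  set E := ∑ i, ∑ j, w i j * ‖x i - Matrix.toEuclideanLin (ρ i j) (x j)‖ ^ 2
  set Et := ∑ i, ∑ j, w i j * ‖xt i - Matrix.toEuclideanLin (ρ i j) (xt j)‖ ^ 2
  set Vs := ∑ i, (∑ j, w i j) * ‖xt i‖ ^ 2
  set R := ∑ i, ∑ j, w i j * (‖x i‖ - ‖x j‖) ^ 2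
  clear_value E Et Vs R M vol
  obtain ⟨e, he⟩ : ∃ e, e = (1 / 2 * E) / lam2 := ⟨_, rfl⟩
  have hEe : E = 2 * (lam2 * e) := by rw [he]; field_simp
  have he0 : 0 ≤ e := by rw [he]; positivity
  -- volume bound
  have hDe : vol - M ≤ e := by
    have h1 : vol * (lam2 * (vol - M)) ≤ vol * (lam2 * e) := by
      have : lam2 * (vol * vol - M ^ 2) ≤ vol * (lam2 * e) := by
        have := mul_le_mul_of_nonneg_left hradial hvol.le
        nlinarith
      have h2 : 0 ≤ lam2 * ((vol - M) * M) := mul_nonneg hpos.le (mul_nonneg (by linarith) hM0)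
      nlinarith
    exact le_of_mul_le_mul_left (le_of_mul_le_mul_left h1 hvol) hpos
  have hle : lam2 * e ≤ 2 * e := mul_le_mul_of_nonneg_right hl2 he0
  have hgoal : 44 * ((1 / 2 * E) / vol / lam2) = 44 * e / vol := by
    rw [he]; field_simp
  rw [hgoal]
  rcases hVs0.eq_or_lt with h0 | hVpos
  · rw [← h0, div_zero]; positivity
  rw [div_le_div_iff₀ hVpos hvol]
  by_cases hc : 2 * vol ≤ 44 * e
  · nlinarith
  · push Not at hc
    have h1 : 10 / 11 * vol ≤ Vs := by linarith
    have h2 : 1 / 2 * Et ≤ 40 * e := by linarith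
    nlinarith [mul_le_mul_of_nonneg_right h2 hvol.le, mul_le_mul_of_nonneg_left h1 he0]
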